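/- Let Π be any protocol for the bit-exchange task that is resilient to an unbounded amount of erasures. Then Π is not coordinated: there exist inputs (x,y) ∈ {0,1}² and a finite noise pattern P such that in the execution Π(x,y‖P), Alice and Bob terminate at different rounds. -/

import Mathlib

/-!
Model of two-party deterministic alternating protocols for the bit-exchange task over
an erasure channel (Appendix A of "Interactive coding resilient to an unknown number
of erasures").  Alice holds a bit `x`, Bob a bit `y`; Alice sends in odd rounds and
Bob in even rounds.  A reception is `none` (the erasure mark ⊥), `some none` (silence
`□`, heard when the partner has already terminated), or `some (some a)` for a channel
symbol `a`.  A party's behaviour at each round is a deterministic function of its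
input and its reception history: what it sends (when it is the sender), whether it
terminates at that round, and, upon termination, its output bit.
A noise pattern `P : ℕ → Bool` tells which rounds' transmissions are erased.
-/

namespace BitExchange

/-- A reception: `none` = erasure mark ⊥, `some none` = silence `□`,
`some (some a)` = channel symbol `a`. -/
abbrev Rcv (S : Type) := Option (Option S)

/-- A deterministic alternating bit-exchange protocol over channel alphabet `S`. -/
structure Protocol (S : Type) where
  /-- The symbol Alice sends, given her input and reception history. -/
  aSend : Bool → List (Rcv S) → S
  /-- Whether Alice terminates at the given round, as a function of her view. -/
  aHalt : Bool → ℕ → List (Rcv S) → Bool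
  /-- Alice's output upon termination. -/
  aOut : Bool → ℕ → List (Rcv S) → Bool
  /-- The symbol Bob sends, given his input and reception history. -/
  bSend : Bool → List (Rcv S) → S
  /-- Whether Bob terminates at the given round, as a function of his view. -/
  bHalt : Bool → ℕ → List (Rcv S) → Bool
  /-- Bob's output upon termination. -/
  bOut : Bool → ℕ → List (Rcv S) → Bool

/-- Execution state after some number of rounds: the parties' reception histories and
their termination rounds (if they have terminated). -/
structure ExSt (S : Type) where
  aH : List (Rcv S)
  bH : List (Rcv S)
  aD : Option ℕ
  bD : Option ℕ

/-- The initial execution state. -/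
def initEx (S : Type) : ExSt S := ⟨[], [], none, none⟩

/-- One round of the execution of protocol `Pr` on inputs `x, y` with noise pattern
`P` (round `r`; odd rounds: Alice sends, Bob receives; even rounds vice versa; a
terminated sender is heard as silence `□`; at the end of the round each still-active
party terminates if its halting predicate holds on its current view). -/
def stepEx {S : Type} (Pr : Protocol S) (x y : Bool) (P : ℕ → Bool) (r : ℕ)
    (s : ExSt S) : ExSt S :=
  if r % 2 = 1 then
    let rcv : Rcv S :=
      if P r then none
      else if s.aD.isSome then some none else some (some (Pr.aSend x s.aH))
    let bH' := s.bH ++ [rcv]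
    { aH := s.aH, bH := bH',
      aD := if s.aD.isSome then s.aD else if Pr.aHalt x r s.aH then some r else none,
      bD := if s.bD.isSome then s.bD else if Pr.bHalt y r bH' then some r else none }
  else
    let rcv : Rcv S :=
      if P r then none
      else if s.bD.isSome then some none else some (some (Pr.bSend y s.bH))
    let aH' := s.aH ++ [rcv]
    { aH := aH', bH := s.bH,
      aD := if s.aD.isSome then s.aD else if Pr.aHalt x r aH' then some r else none,
      bD := if s.bD.isSome then s.bD else if Pr.bHalt y r s.bH then some r else none }

/-- The execution state of `Π(x,y‖P)` after `r` rounds. -/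
def exAt {S : Type} (Pr : Protocol S) (x y : Bool) (P : ℕ → Bool) : ℕ → ExSt S
  | 0 => initEx S
  | r + 1 => stepEx Pr x y P (r + 1) (exAt Pr x y P r)

/-- Alice terminates at round `i` in the execution `Π(x,y‖P)`. -/
def aliceTermAt {S : Type} (Pr : Protocol S) (x y : Bool) (P : ℕ → Bool) (i : ℕ) :
    Prop :=
  (exAt Pr x y P i).aD = some i

/-- Bob terminates at round `i` in the execution `Π(x,y‖P)`. -/
def bobTermAt {S : Type} (Pr : Protocol S) (x y : Bool) (P : ℕ → Bool) (i : ℕ) :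
    Prop :=
  (exAt Pr x y P i).bD = some i

/-- A noise pattern is finite if it erases only finitely many rounds. -/
def FiniteNoise (P : ℕ → Bool) : Prop := ∃ n, ∀ m, n ≤ m → P m = false

/-- `Pr` is resilient to an unbounded amount of erasures: on every pair of inputs and
every finite noise pattern, both parties terminate and output the other party's bit. -/
def Resilient {S : Type} (Pr : Protocol S) : Prop :=
  ∀ x y : Bool, ∀ P : ℕ → Bool, FiniteNoise P →
    (∃ i, aliceTermAt Pr x y P i ∧ Pr.aOut x i (exAt Pr x y P i).aH = y) ∧
    (∃ j, bobTermAt Pr x y P j ∧ Pr.bOut y j (exAt Pr x y P j).bH = x)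

/-- `Pr` is coordinated: in every execution (any inputs, any finite noise pattern)
Alice and Bob terminate at the same round. -/
def Coordinated {S : Type} (Pr : Protocol S) : Prop :=
  ∀ x y : Bool, ∀ P : ℕ → Bool, FiniteNoise P → ∀ i j,
    aliceTermAt Pr x y P i → bobTermAt Pr x y P j → i = j

/-- `Pr` has coordinated-termination at round `i`: some inputs and some finite noise
pattern make both parties terminate at round `i`. -/
def CoordTermAt {S : Type} (Pr : Protocol S) (i : ℕ) : Prop :=
  ∃ x y : Bool, ∃ P : ℕ → Bool, FiniteNoise P ∧
    aliceTermAt Pr x y P i ∧ bobTermAt Pr x y P i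

theorem exAt_congr {S : Type} (Pr : Protocol S) (x y : Bool) {P Q : ℕ → Bool} {m : ℕ}
    (h : ∀ r, r ≤ m → P r = Q r) : exAt Pr x y P m = exAt Pr x y Q m := by
  induction m with
  | zero => rfl
  | succ m ih =>
    simp only [exAt, ih fun r hr => h r (by omega), stepEx, h (m + 1) le_rfl]

/-- Alice's view evolves independently of Bob while all transmissions to her are erased. -/
theorem alice_view_congr {S : Type} (Pr : Protocol S) (x y y' : Bool) {P Q : ℕ → Bool} {m n : ℕ}
    (hmn : m ≤ n)
    (hH : (exAt Pr x y P m).aH = (exAt Pr x y' Q m).aH)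
    (hD : (exAt Pr x y P m).aD = (exAt Pr x y' Q m).aD)
    (h : ∀ r, m < r → r ≤ n → r % 2 = 0 → P r = true ∧ Q r = true) :
    (exAt Pr x y P n).aH = (exAt Pr x y' Q n).aH ∧
      (exAt Pr x y P n).aD = (exAt Pr x y' Q n).aD := by
  induction n, hmn using Nat.le_induction with
  | base => exact ⟨hH, hD⟩
  | succ n hmn ih =>
    obtain ⟨ihH, ihD⟩ := ih fun r h₁ h₂ => h r h₁ (by omega)
    by_cases hp : (n + 1) % 2 = 1
    · simp only [exAt, stepEx, hp, if_true, ihH, ihD, and_self]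
    · obtain ⟨hP, hQ⟩ := h (n + 1) (by omega) le_rfl (by omega)
      simp only [exAt, stepEx, hp, if_false, hP, hQ, if_true, ihH, ihD, and_self]

/-- Bob's view evolves independently of Alice while all transmissions to him are erased. -/
theorem bob_view_congr {S : Type} (Pr : Protocol S) (x x' y : Bool) {P Q : ℕ → Bool} {m n : ℕ}
    (hmn : m ≤ n)
    (hH : (exAt Pr x y P m).bH = (exAt Pr x' y Q m).bH)
    (hD : (exAt Pr x y P m).bD = (exAt Pr x' y Q m).bD)
    (h : ∀ r, m < r → r ≤ n → r % 2 = 1 → P r = true ∧ Q r = true) :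
    (exAt Pr x y P n).bH = (exAt Pr x' y Q n).bH ∧
      (exAt Pr x y P n).bD = (exAt Pr x' y Q n).bD := by
  induction n, hmn using Nat.le_induction with
  | base => exact ⟨hH, hD⟩
  | succ n hmn ih =>
    obtain ⟨ihH, ihD⟩ := ih fun r h₁ h₂ => h r h₁ (by omega)
    by_cases hp : (n + 1) % 2 = 1
    · obtain ⟨hP, hQ⟩ := h (n + 1) (by omega) le_rfl hp
      simp only [exAt, stepEx, hp, hP, hQ, if_true, ihH, ihD, and_self]
    · simp only [exAt, stepEx, hp, if_false, ihH, ihD, and_self]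

theorem aD_eq_some_of_le {S : Type} {Pr : Protocol S} {x y : Bool} {P : ℕ → Bool} {i m n : ℕ}
    (hmn : m ≤ n) (h : (exAt Pr x y P m).aD = some i) : (exAt Pr x y P n).aD = some i := by
  induction n, hmn using Nat.le_induction with
  | base => exact h
  | succ n _ ih => by_cases hp : (n + 1) % 2 = 1 <;> simp [exAt, stepEx, hp, ih]

theorem aliceTermAt_unique {S : Type} {Pr : Protocol S} {x y : Bool} {P : ℕ → Bool} {i j : ℕ}
    (hi : aliceTermAt Pr x y P i) (hj : aliceTermAt Pr x y P j) : i = j :=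
  Option.some_injective _ <|
    (aD_eq_some_of_le (le_max_left i j) hi).symm.trans (aD_eq_some_of_le (le_max_right i j) hj)

/-- The noise pattern `P` with the rounds `k + 1, …, n` erased in addition. -/
def eraseBetween (P : ℕ → Bool) (k n : ℕ) (r : ℕ) : Bool :=
  P r || decide (k < r ∧ r ≤ n)

theorem eraseBetween_of_le {P : ℕ → Bool} {k n r : ℕ} (h : r ≤ k) :
    eraseBetween P k n r = P r := by
  simp [eraseBetween, h.not_gt]

theorem eraseBetween_eq_true {P : ℕ → Bool} {k n r : ℕ} (h₁ : k < r) (h₂ : r ≤ n) :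
    eraseBetween P k n r = true := by
  simp [eraseBetween, h₁, h₂]

theorem FiniteNoise.eraseBetween {P : ℕ → Bool} (hP : FiniteNoise P) (k n : ℕ) :
    FiniteNoise (eraseBetween P k n) := by
  obtain ⟨N, hN⟩ := hP
  refine ⟨max N (n + 1), fun m hm => ?_⟩
  have hlt : ¬ m ≤ n := by omega
  simp [BitExchange.eraseBetween, hN m (by omega), hlt]

/-- In a coordinated resilient protocol, erasing any block of final rounds of an execution
does not change the round at which the parties terminate. -/
theorem termAt_eraseBetween {S : Type} {Pr : Protocol S} (hres : Resilient Pr)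
    (hc : Coordinated Pr) {x y : Bool} {P : ℕ → Bool} (hP : FiniteNoise P) {k n : ℕ} (hk : k ≤ n)
    (ha : aliceTermAt Pr x y P n) (hb : bobTermAt Pr x y P n) :
    aliceTermAt Pr x y (eraseBetween P k n) n ∧ bobTermAt Pr x y (eraseBetween P k n) n := by
  induction hk using Nat.decreasingInduction with
  | self =>
    have h : exAt Pr x y (eraseBetween P n n) n = exAt Pr x y P n :=
      exAt_congr Pr x y fun r hr => eraseBetween_of_le hr
    simpa only [aliceTermAt, bobTermAt, h] using And.intro ha hb
  | of_succ k hk ih =>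
    have hpre : exAt Pr x y (eraseBetween P k n) k = exAt Pr x y (eraseBetween P (k + 1) n) k :=
      exAt_congr Pr x y fun r hr => by
        rw [eraseBetween_of_le hr, eraseBetween_of_le (by omega)]
    have hfin := hP.eraseBetween k n
    obtain ⟨⟨i, hi, -⟩, ⟨j, hj, -⟩⟩ := hres x y _ hfin
    by_cases hp : (k + 1) % 2 = 1
    · have hA : aliceTermAt Pr x y (eraseBetween P k n) n :=
        (alice_view_congr Pr x y y hk.le (by rw [hpre]) (by rw [hpre]) fun r h₁ h₂ h₃ =>
          ⟨eraseBetween_eq_true h₁ h₂, eraseBetween_eq_true (by omega) h₂⟩).2.trans ih.1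
      obtain rfl := hc x y _ hfin n j hA hj
      exact ⟨hA, hj⟩
    · have hB : bobTermAt Pr x y (eraseBetween P k n) n :=
        (bob_view_congr Pr x x y hk.le (by rw [hpre]) (by rw [hpre]) fun r h₁ h₂ h₃ =>
          ⟨eraseBetween_eq_true h₁ h₂, eraseBetween_eq_true (by omega) h₂⟩).2.trans ih.2
      obtain rfl := hc x y _ hfin i n hi hB
      exact ⟨hi, hB⟩

theorem Resilient.not_coordinated {S : Type} {Pr : Protocol S} (hres : Resilient Pr) :
    ¬ Coordinated Pr := by
  intro hc
  have hP : FiniteNoise fun _ => false := ⟨0, fun _ _ => rfl⟩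
  obtain ⟨⟨n, ha, -⟩, ⟨j, hb, -⟩⟩ := hres true true _ hP
  obtain rfl := hc _ _ _ hP n j ha hb
  have hT := (termAt_eraseBetween hres hc hP n.zero_le ha hb).1
  have hfin := hP.eraseBetween 0 n
  obtain ⟨hH, hD⟩ := alice_view_congr Pr true true false (m := 0) n.zero_le rfl rfl
    fun r h₁ h₂ _ => ⟨eraseBetween_eq_true (P := fun _ => false) h₁ h₂,
      eraseBetween_eq_true (P := fun _ => false) h₁ h₂⟩
  obtain ⟨i, hi, hout⟩ := (hres true true _ hfin).1
  obtain ⟨j, hj, hout'⟩ := (hres true false _ hfin).1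
  obtain rfl := aliceTermAt_unique hT hi
  obtain rfl := aliceTermAt_unique (hD.symm.trans hT) hj
  rw [hH, hout'] at hout
  exact Bool.false_ne_true hout

/-- Lemma 23 of the paper.  Every protocol for the bit-exchange
task that is resilient to an unbounded amount of erasures fails to be coordinated:
there are inputs `(x,y)` and a finite noise pattern `P` such that in `Π(x,y‖P)` Alice
and Bob terminate at different rounds. -/
theorem resilient_implies_not_coordinated
    {S : Type} (Pr : Protocol S) (hres : Resilient Pr) :
    ∃ x y : Bool, ∃ P : ℕ → Bool, FiniteNoise P ∧
      ∃ i j, aliceTermAt Pr x y P i ∧ bobTermAt Pr x y P j ∧ i ≠ j := by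
  have h := hres.not_coordinated
  unfold Coordinated at h
  push Not at h
  obtain ⟨x, y, P, hP, i, j, hi, hj, hij⟩ := h
  exact ⟨x, y, P, hP, i, j, hi, hj, hij⟩

end BitExchange
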